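/- There is exactly one vertex w with μ(w) = +1 that is not the A-partner of any vertex v with μ(v) = −1, and exactly one vertex w′ with μ(w′) = +1 that is not the B-partner of any vertex v with μ(v) = −1. -/

import Mathlib

open Finset

/-- The open counterclockwise arc `{v+1, …, v+(k-1)}` (indexed by `i = 1,…,k-1`) is
balanced: it contains as many elements where `μ = 1` as elements where `μ = -1`. -/
def ArcBalanced (n : ℕ) (μ : ZMod (2*n+1) → ℤ) (v : ZMod (2*n+1)) (k : ℕ) : Prop :=
  ((Finset.Icc 1 (k-1)).filter fun i : ℕ => μ (v + (i : ZMod (2*n+1))) = 1).card =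
  ((Finset.Icc 1 (k-1)).filter fun i : ℕ => μ (v + (i : ZMod (2*n+1))) = -1).card

/-- `k` is a valid cancellation length for an `A`-band at `v`:
`μ (v+k) = 1` and the open arc `{v+1, …, v+(k-1)}` is balanced. -/
def AGood (n : ℕ) (μ : ZMod (2*n+1) → ℤ) (v : ZMod (2*n+1)) (k : ℕ) : Prop :=
  μ (v + (k : ZMod (2*n+1))) = 1 ∧ ArcBalanced n μ v k

/-- `k` is a valid cancellation length for a `B`-band at `v`:
`μ (v-k) = 1` and the open arc `{v-k+1, …, v-1}` is balanced. -/
def BGood (n : ℕ) (μ : ZMod (2*n+1) → ℤ) (v : ZMod (2*n+1)) (k : ℕ) : Prop :=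
  μ (v - (k : ZMod (2*n+1))) = 1 ∧ ArcBalanced n μ (v - (k : ZMod (2*n+1))) k

/-- `w` is the `A`-partner of `v`: `w = v + k` for the least `k ∈ {1,…,2n}` with
`μ (v+k) = 1` and the open arc `{v+1,…,v+(k-1)}` balanced. -/
def IsAPartner (n : ℕ) (μ : ZMod (2*n+1) → ℤ) (v w : ZMod (2*n+1)) : Prop :=
  ∃ k ∈ Finset.Icc 1 (2*n), AGood n μ v k ∧
    (∀ j ∈ Finset.Icc 1 (2*n), j < k → ¬ AGood n μ v j) ∧ w = v + (k : ZMod (2*n+1))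

/-- `w` is the `B`-partner of `v`: `w = v - k` for the least `k ∈ {1,…,2n}` with
`μ (v-k) = 1` and the open arc `{v-k+1,…,v-1}` balanced. -/
def IsBPartner (n : ℕ) (μ : ZMod (2*n+1) → ℤ) (v w : ZMod (2*n+1)) : Prop :=
  ∃ k ∈ Finset.Icc 1 (2*n), BGood n μ v k ∧
    (∀ j ∈ Finset.Icc 1 (2*n), j < k → ¬ BGood n μ v j) ∧ w = v - (k : ZMod (2*n+1))

/-- The auxiliary graph `G(μ)`: its edges are exactly the unordered pairs
`{v, A-partner of v}` and `{v, B-partner of v}` over all `v` with `μ v = -1`. -/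
def G (n : ℕ) (μ : ZMod (2*n+1) → ℤ) : SimpleGraph (ZMod (2*n+1)) :=
  SimpleGraph.fromRel fun x y => μ x = -1 ∧ (IsAPartner n μ x y ∨ IsBPartner n μ x y)

noncomputable instance {n : ℕ} {μ : ZMod (2*n+1) → ℤ} {v : ZMod (2*n+1)} :
    Fintype ((G n μ).neighborSet v) := Fintype.ofFinite _

/-- The sum of `μ` over the arc `{v+1, …, v+k}`. -/
def arcSum (n : ℕ) (μ : ZMod (2*n+1) → ℤ) (v : ZMod (2*n+1)) (k : ℕ) : ℤ :=
  ∑ i ∈ Finset.range k, μ (v + ((i + 1 : ℕ) : ZMod (2*n+1)))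

lemma sum_eq_card_sub_card {ι : Type*} (s : Finset ι) (f : ι → ℤ)
    (hf : ∀ i, f i = 1 ∨ f i = -1) :
    ∑ i ∈ s, f i = ((s.filter fun i => f i = 1).card : ℤ) - (s.filter fun i => f i = -1).card := by
  rw [Finset.card_filter, Finset.card_filter]
  push_cast
  rw [← Finset.sum_sub_distrib]
  refine Finset.sum_congr rfl fun i _ => ?_
  rcases hf i with h | h <;> simp [h]

lemma arcBalanced_iff {n : ℕ} {μ : ZMod (2*n+1) → ℤ} (hval : ∀ v, μ v = 1 ∨ μ v = -1)
    (v : ZMod (2*n+1)) (k : ℕ) : ArcBalanced n μ v k ↔ arcSum n μ v (k - 1) = 0 := by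
  have h : arcSum n μ v (k - 1) = ∑ i ∈ Finset.Icc 1 (k - 1), μ (v + (i : ZMod (2*n+1))) := by
    rw [arcSum, Finset.range_eq_Ico,
      Finset.sum_Ico_add' (fun i : ℕ => μ (v + (i : ZMod (2*n+1)))) 0 (k - 1) 1]
    rfl
  rw [h, sum_eq_card_sub_card _ _ fun i : ℕ => hval (v + i), ArcBalanced]
  omega

lemma arcSum_succ {n : ℕ} (μ : ZMod (2*n+1) → ℤ) (v : ZMod (2*n+1)) (k : ℕ) :
    arcSum n μ v (k + 1) = arcSum n μ v k + μ (v + ((k + 1 : ℕ) : ZMod (2*n+1))) :=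
  Finset.sum_range_succ _ _

lemma arcSum_add {n : ℕ} (μ : ZMod (2*n+1) → ℤ) (v : ZMod (2*n+1)) (k l : ℕ) :
    arcSum n μ v (k + l) = arcSum n μ v k + arcSum n μ (v + (k : ZMod (2*n+1))) l := by
  rw [arcSum, Finset.sum_range_add]
  refine congrArg _ (Finset.sum_congr rfl fun i _ => congrArg μ ?_)
  push_cast
  ring

lemma arcSum_full {n : ℕ} (μ : ZMod (2*n+1) → ℤ) (v : ZMod (2*n+1)) :
    arcSum n μ v (2 * n + 1) = ∑ x, μ x := by
  rw [← Equiv.sum_comp (Equiv.addLeft (v + 1)) μ, arcSum]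
  refine Finset.sum_nbij' (fun i : ℕ => (i : ZMod (2*n+1))) ZMod.val (by simp)
    (fun x _ => Finset.mem_range.2 (ZMod.val_lt x))
    (fun i hi => ZMod.val_cast_of_lt (Finset.mem_range.1 hi)) (by simp) fun i _ => ?_
  simp only [Equiv.coe_addLeft]
  push_cast
  congr 1
  ring

/-- An arc of positive sum starting at `v` contains a valid cancellation length. -/
lemma exists_aGood_of_arcSum_pos {n : ℕ} {μ : ZMod (2*n+1) → ℤ}
    (hval : ∀ v, μ v = 1 ∨ μ v = -1) (v : ZMod (2*n+1)) (m : ℕ) (hm : 0 < arcSum n μ v m) :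
    ∃ k, 1 ≤ k ∧ k ≤ m ∧ AGood n μ v k := by
  induction m with
  | zero => simp [arcSum] at hm
  | succ m ih =>
    by_cases h : 0 < arcSum n μ v m
    · obtain ⟨k, h1, h2, h3⟩ := ih h
      exact ⟨k, h1, by omega, h3⟩
    · have hs := arcSum_succ μ v m
      refine ⟨m + 1, by omega, le_rfl, ?_, (arcBalanced_iff hval _ _).2 ?_⟩
      · rcases hval (v + ((m + 1 : ℕ) : ZMod (2*n+1))) with h' | h' <;> omega
      · rw [Nat.add_sub_cancel]
        rcases hval (v + ((m + 1 : ℕ) : ZMod (2*n+1))) with h' | h' <;> omega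

lemma exists_isAPartner {n : ℕ} {μ : ZMod (2*n+1) → ℤ} (hval : ∀ v, μ v = 1 ∨ μ v = -1)
    (hsum : ∑ x, μ x = 1) {v : ZMod (2*n+1)} (hv : μ v = -1) :
    ∃ w, μ w = 1 ∧ IsAPartner n μ v w := by
  classical
  have hpos : 0 < arcSum n μ v (2 * n) := by
    have h1 := arcSum_full μ v
    have h2 : v + ((2 * n + 1 : ℕ) : ZMod (2*n+1)) = v := by
      rw [ZMod.natCast_self, add_zero]
    rw [arcSum_succ, h2] at h1
    omega
  have hex : ∃ k, 1 ≤ k ∧ k ≤ 2 * n ∧ AGood n μ v k :=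
    exists_aGood_of_arcSum_pos hval v _ hpos
  obtain ⟨h1, h2, h3⟩ := Nat.find_spec hex
  refine ⟨_, h3.1, Nat.find hex, Finset.mem_Icc.2 ⟨h1, h2⟩, h3, fun j hj hlt hg => ?_, rfl⟩
  exact Nat.find_min hex hlt ⟨(Finset.mem_Icc.1 hj).1, (Finset.mem_Icc.1 hj).2, hg⟩

lemma IsAPartner.unique {n : ℕ} {μ : ZMod (2*n+1) → ℤ} {v w w' : ZMod (2*n+1)}
    (h : IsAPartner n μ v w) (h' : IsAPartner n μ v w') : w = w' := by
  obtain ⟨k, hk, hg, hmin, rfl⟩ := h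
  obtain ⟨l, hl, hg', hmin', rfl⟩ := h'
  rcases lt_trichotomy k l with hlt | rfl | hlt
  · exact absurd hg (hmin' k hk hlt)
  · rfl
  · exact absurd hg' (hmin l hl hlt)

/-- If the arcs of two cancellations end at the same vertex, the longer one is not minimal. -/
lemma exists_aGood_lt {n : ℕ} {μ : ZMod (2*n+1) → ℤ} (hval : ∀ v, μ v = 1 ∨ μ v = -1)
    {v v' : ZMod (2*n+1)} {k l : ℕ} (hv : μ v = -1) (hk : 1 ≤ k) (hkl : k < l)
    (h : AGood n μ v k) (h' : AGood n μ v' l)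
    (heq : v + (k : ZMod (2*n+1)) = v' + (l : ZMod (2*n+1))) :
    ∃ j, 1 ≤ j ∧ j < l ∧ AGood n μ v' j := by
  obtain ⟨d, rfl⟩ : ∃ d, l = d + 1 + k := ⟨l - k - 1, by omega⟩
  have hvv : v = v' + ((d + 1 : ℕ) : ZMod (2*n+1)) := by
    push_cast at heq ⊢
    linear_combination heq
  have e := (arcBalanced_iff hval _ _).1 h.2
  have e' := (arcBalanced_iff hval _ _).1 h'.2
  rw [show d + 1 + k - 1 = (d + 1) + (k - 1) by omega, arcSum_add, ← hvv, e, arcSum_succ,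
    ← hvv, hv] at e'
  obtain ⟨j, h1, h2, h3⟩ := exists_aGood_of_arcSum_pos hval v' d (by omega)
  exact ⟨j, h1, by omega, h3⟩

lemma IsAPartner.injective {n : ℕ} {μ : ZMod (2*n+1) → ℤ} (hval : ∀ v, μ v = 1 ∨ μ v = -1)
    {v v' w : ZMod (2*n+1)} (hv : μ v = -1) (hv' : μ v' = -1)
    (h : IsAPartner n μ v w) (h' : IsAPartner n μ v' w) : v = v' := by
  obtain ⟨k, hk, hg, hmin, rfl⟩ := h
  obtain ⟨l, hl, hg', hmin', heq⟩ := h'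
  rw [Finset.mem_Icc] at hk hl
  rcases lt_trichotomy k l with hlt | rfl | hlt
  · obtain ⟨j, h1, h2, h3⟩ := exists_aGood_lt hval hv hk.1 hlt hg hg' heq
    exact absurd h3 (hmin' j (Finset.mem_Icc.2 ⟨h1, by omega⟩) h2)
  · exact add_right_cancel heq
  · obtain ⟨j, h1, h2, h3⟩ := exists_aGood_lt hval hv' hl.1 hlt hg' hg heq.symm
    exact absurd h3 (hmin j (Finset.mem_Icc.2 ⟨h1, by omega⟩) h2)

lemma existsUnique_not_isAPartner {n : ℕ} {μ : ZMod (2*n+1) → ℤ}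
    (hval : ∀ v, μ v = 1 ∨ μ v = -1)
    (hplus : (Finset.univ.filter fun v : ZMod (2*n+1) => μ v = 1).card = n + 1)
    (hminus : (Finset.univ.filter fun v : ZMod (2*n+1) => μ v = -1).card = n) :
    ∃! w : ZMod (2*n+1), μ w = 1 ∧ ¬ ∃ v : ZMod (2*n+1), μ v = -1 ∧ IsAPartner n μ v w := by
  classical
  have hsum : ∑ x, μ x = 1 := by
    rw [sum_eq_card_sub_card _ _ hval, hplus, hminus]
    push_cast
    ring
  choose! p hp1 hp using fun v (hv : μ v = -1) => exists_isAPartner hval hsum hv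
  set P := Finset.univ.filter fun v : ZMod (2*n+1) => μ v = 1
  set M := Finset.univ.filter fun v : ZMod (2*n+1) => μ v = -1
  have hM : ∀ v, v ∈ M ↔ μ v = -1 := by simp [M]
  have hsub : M.image p ⊆ P := by
    intro w hw
    obtain ⟨v, hv, rfl⟩ := Finset.mem_image.1 hw
    simpa [P] using hp1 v ((hM v).1 hv)
  have hinj : Set.InjOn p M := fun v hv v' hv' h => by
    have hv := (hM v).1 hv
    have hv' := (hM v').1 hv'
    exact IsAPartner.injective hval hv hv' (hp v hv) (h ▸ hp v' hv')
  have hcard : (P \ M.image p).card = 1 := by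
    rw [Finset.card_sdiff_of_subset hsub, Finset.card_image_of_injOn hinj, hplus, hminus]
    omega
  have hmem : ∀ w, w ∈ P \ M.image p ↔
      μ w = 1 ∧ ¬ ∃ v : ZMod (2*n+1), μ v = -1 ∧ IsAPartner n μ v w := by
    intro w
    simp only [Finset.mem_sdiff, Finset.mem_image, hM]
    refine and_congr (by simp [P]) (not_congr (exists_congr fun v => and_congr_right fun hv => ?_))
    exact ⟨fun h => h ▸ hp v hv, fun h => (hp v hv).unique h⟩
  obtain ⟨w, hw⟩ := Finset.card_eq_one.1 hcard
  simp only [← hmem, hw, Finset.mem_singleton]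
  exact ⟨w, rfl, fun _ h => h⟩

lemma arcSum_neg {n : ℕ} (μ : ZMod (2*n+1) → ℤ) (v : ZMod (2*n+1)) {k : ℕ} (hk : 1 ≤ k) :
    arcSum n (fun x => μ (-x)) (-v) (k - 1) =
      arcSum n μ (v - (k : ZMod (2*n+1))) (k - 1) := by
  obtain ⟨k, rfl⟩ := Nat.exists_eq_add_of_le' hk
  rw [Nat.add_sub_cancel, arcSum, arcSum, ← Finset.sum_range_reflect]
  refine Finset.sum_congr rfl fun i hi => congrArg μ ?_
  rw [Finset.mem_range] at hi
  obtain ⟨d, rfl⟩ : ∃ d, k = d + 1 + i := ⟨k - 1 - i, by omega⟩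
  rw [show d + 1 + i - 1 - i = d by omega]
  push_cast
  ring

lemma aGood_neg_iff {n : ℕ} {μ : ZMod (2*n+1) → ℤ} (hval : ∀ v, μ v = 1 ∨ μ v = -1)
    (v : ZMod (2*n+1)) {k : ℕ} (hk : 1 ≤ k) :
    AGood n (fun x => μ (-x)) (-v) k ↔ BGood n μ v k := by
  rw [AGood, BGood, arcBalanced_iff hval, arcBalanced_iff fun x => hval (-x), arcSum_neg μ v hk,
    show -(-v + (k : ZMod (2*n+1))) = v - k by ring]

lemma isAPartner_neg_iff {n : ℕ} {μ : ZMod (2*n+1) → ℤ} (hval : ∀ v, μ v = 1 ∨ μ v = -1)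
    (v w : ZMod (2*n+1)) :
    IsAPartner n (fun x => μ (-x)) (-v) (-w) ↔ IsBPartner n μ v w := by
  refine exists_congr fun k => and_congr_right fun hk => ?_
  refine and_congr (aGood_neg_iff hval v (Finset.mem_Icc.1 hk).1) (and_congr ?_ ?_)
  · exact forall_congr' fun j => forall_congr' fun hj => imp_congr_right fun _ =>
      not_congr (aGood_neg_iff hval v (Finset.mem_Icc.1 hj).1)
  · rw [neg_eq_iff_eq_neg, neg_add, neg_neg, sub_eq_add_neg]

theorem unique_non_partner (n : ℕ) (μ : ZMod (2*n+1) → ℤ)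
    (hn : 0 < n)
    (hval : ∀ v, μ v = 1 ∨ μ v = -1)
    (hplus : (Finset.univ.filter fun v : ZMod (2*n+1) => μ v = 1).card = n + 1)
    (hminus : (Finset.univ.filter fun v : ZMod (2*n+1) => μ v = -1).card = n) :
    (∃! w : ZMod (2*n+1), μ w = 1 ∧ ¬ ∃ v : ZMod (2*n+1), μ v = -1 ∧ IsAPartner n μ v w) ∧
    (∃! w' : ZMod (2*n+1), μ w' = 1 ∧ ¬ ∃ v : ZMod (2*n+1), μ v = -1 ∧ IsBPartner n μ v w') := by
  refine ⟨existsUnique_not_isAPartner hval hplus hminus, ?_⟩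
  have hcard : ∀ c : ℤ, (Finset.univ.filter fun v : ZMod (2*n+1) => μ (-v) = c).card =
      (Finset.univ.filter fun v : ZMod (2*n+1) => μ v = c).card := fun c =>
    Finset.card_equiv (Equiv.neg _) (by simp)
  have key := existsUnique_not_isAPartner (μ := fun x => μ (-x)) (fun v => hval (-v))
    ((hcard 1).trans hplus) ((hcard (-1)).trans hminus)
  refine ((Equiv.neg (ZMod (2*n+1))).existsUnique_congr fun {w} => ?_).2 key
  refine and_congr (by simp) (not_congr ((Equiv.neg _).exists_congr fun v => ?_))
  simp only [Equiv.neg_apply, neg_neg, isAPartner_neg_iff hval]
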